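/- arXiv:1906.01339 — 2 statements merged into one kernel-verified Lean document; each statement's English description precedes it below -/
import Mathlib

section
/- Let M ∈ ℝ^{m×n} have rows M_1, …, M_m and let ε > 0. Then the Euclidean gradient map x ↦ Grad f(x) = −∑_{i=1}^m (⟨M_i, x⟩ / √(⟨M_i, x⟩² + ε)) M_i of f(x) = −∑_{i=1}^m √(⟨M_i, x⟩² + ε) is Lipschitz continuous on ℝ^n with Lipschitz constant (2/√ε) · ∑_{i=1}^m ‖M_i‖₂², i.e., ‖Grad f(x) − Grad f(y)‖₂ ≤ (2/√ε)(∑_{i=1}^m ‖M_i‖₂²)·‖x − y‖₂ for all x, y ∈ ℝ^n. -/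
open Finset Real RealInnerProductSpace

theorem abs_sqrt_sq_add_sub_le {ε : ℝ} (hε : 0 < ε) (a b : ℝ) :
    |√(a ^ 2 + ε) - √(b ^ 2 + ε)| ≤ |a - b| := by
  have hA : |a| ≤ √(a ^ 2 + ε) := Real.abs_le_sqrt (by linarith)
  have hB : |b| ≤ √(b ^ 2 + ε) := Real.abs_le_sqrt (by linarith)
  have hA0 : 0 < √(a ^ 2 + ε) := by positivity
  have hB0 : 0 < √(b ^ 2 + ε) := by positivity
  have hmul : (√(a ^ 2 + ε) - √(b ^ 2 + ε)) * (√(a ^ 2 + ε) + √(b ^ 2 + ε))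
      = (a - b) * (a + b) := by
    have h1 : √(a ^ 2 + ε) ^ 2 = a ^ 2 + ε := Real.sq_sqrt (by positivity)
    have h2 : √(b ^ 2 + ε) ^ 2 = b ^ 2 + ε := Real.sq_sqrt (by positivity)
    linear_combination h1 - h2
  have hsum : 0 < √(a ^ 2 + ε) + √(b ^ 2 + ε) := by positivity
  refine le_of_mul_le_mul_right ?_ hsum
  calc |√(a ^ 2 + ε) - √(b ^ 2 + ε)| * (√(a ^ 2 + ε) + √(b ^ 2 + ε))
      = |a - b| * |a + b| := by rw [← abs_mul, ← hmul, abs_mul, abs_of_pos hsum]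
    _ ≤ |a - b| * (√(a ^ 2 + ε) + √(b ^ 2 + ε)) := by
      gcongr
      exact (abs_add_le a b).trans (add_le_add hA hB)

theorem abs_div_sqrt_sq_add_sub_le {ε : ℝ} (hε : 0 < ε) (a b : ℝ) :
    |a / √(a ^ 2 + ε) - b / √(b ^ 2 + ε)| ≤ 2 / √ε * |a - b| := by
  have hA0 : 0 < √(a ^ 2 + ε) := by positivity
  have hB0 : 0 < √(b ^ 2 + ε) := by positivity
  have hE0 : 0 < √ε := by positivity
  have hEA : √ε ≤ √(a ^ 2 + ε) := Real.sqrt_le_sqrt (by nlinarith)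
  have hb : |b / √(b ^ 2 + ε)| ≤ 1 := by
    rw [abs_div, abs_of_pos hB0, div_le_one hB0]
    exact Real.abs_le_sqrt (by linarith)
  have hsub := abs_sqrt_sq_add_sub_le hε a b
  have hsplit : a / √(a ^ 2 + ε) - b / √(b ^ 2 + ε)
      = ((a - b) - b / √(b ^ 2 + ε) * (√(a ^ 2 + ε) - √(b ^ 2 + ε))) / √(a ^ 2 + ε) := by
    field_simp
    ring
  rw [hsplit, abs_div, abs_of_pos hA0]
  calc |(a - b) - b / √(b ^ 2 + ε) * (√(a ^ 2 + ε) - √(b ^ 2 + ε))| / √(a ^ 2 + ε)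
      ≤ (|a - b| + 1 * |a - b|) / √ε := by
        gcongr
        refine (abs_sub _ _).trans ?_
        rw [abs_mul]
        gcongr
    _ = 2 / √ε * |a - b| := by ring

/-- The Euclidean gradient map
`G x = -∑ i, (⟨M i, x⟩ / √(⟨M i, x⟩² + ε)) • M i` of `f x = -∑ i, √(⟨M i, x⟩² + ε)` is
Lipschitz on `ℝⁿ` with constant `(2/√ε) · ∑ i, ‖M i‖²`. -/
theorem statement6 (m n : ℕ) (M : Fin m → EuclideanSpace ℝ (Fin n)) (ε : ℝ) (hε : 0 < ε)
    (G : EuclideanSpace ℝ (Fin n) → EuclideanSpace ℝ (Fin n))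
    (hG : ∀ y, G y = -∑ i : Fin m, (⟪M i, y⟫ / Real.sqrt (⟪M i, y⟫ ^ 2 + ε)) • M i) :
    ∀ x y : EuclideanSpace ℝ (Fin n),
      ‖G x - G y‖ ≤ (2 / Real.sqrt ε) * (∑ i : Fin m, ‖M i‖ ^ 2) * ‖x - y‖ := by
  intro x y
  rw [hG, hG, neg_sub_neg, ← Finset.sum_sub_distrib, Finset.mul_sum, Finset.sum_mul]
  refine norm_sum_le_of_le _ fun i _ => ?_
  rw [← sub_smul, norm_smul, Real.norm_eq_abs]
  calc _ ≤ 2 / √ε * |⟪M i, y⟫ - ⟪M i, x⟫| * ‖M i‖ := by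
        gcongr
        exact abs_div_sqrt_sq_add_sub_le hε _ _
    _ ≤ 2 / √ε * (‖M i‖ * ‖x - y‖) * ‖M i‖ := by
        gcongr
        rw [← inner_sub_right, norm_sub_rev]
        exact abs_real_inner_le_norm _ _
    _ = 2 / √ε * ‖M i‖ ^ 2 * ‖x - y‖ := by ring
end

section
/- Let M ∈ ℝ^{m×n} have rows M_1, …, M_m, let ε > 0, and let f(x) = −∑_{i=1}^m √(⟨M_i, x⟩² + ε) with Euclidean gradient Grad f. Define the Riemannian gradient vector field ζ(y) = Grad f(y) − ⟨y, Grad f(y)⟩·y on ℝ^n. Then ζ is differentiable, and for every x with ‖x‖₂ = 1 and every v ∈ ℝ^n, the projected derivative (I − x xᵀ)·Dζ(x)[v] (where Dζ(x)[v] is the Fréchet derivative of ζ at x in direction v) satisfies ‖(I − x xᵀ)·Dζ(x)[v]‖₂ ≤ ((4/√ε)·∑_{i=1}^m ‖M_i‖₂² + 2·∑_{i=1}^m ‖M_i‖₂)·‖v‖₂. In particular the Riemannian Hessian of f on S^{n−1} is uniformly bounded in operator norm over the sphere. -/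
open Finset Real RealInnerProductSpace

section SmoothedSign

variable {ε : ℝ}

/-- The derivative of `t / √(t² + ε)`, the smoothed sign function. -/
theorem hasDerivAt_div_sqrt_sq_add (hε : 0 < ε) (t : ℝ) :
    HasDerivAt (fun s : ℝ => s / √(s ^ 2 + ε)) (ε / √(t ^ 2 + ε) ^ 3) t := by
  have hpos : 0 < t ^ 2 + ε := by positivity
  have hsq : √(t ^ 2 + ε) ^ 2 = t ^ 2 + ε := Real.sq_sqrt hpos.le
  have hs : 0 < √(t ^ 2 + ε) := Real.sqrt_pos.2 hpos
  have h := (hasDerivAt_id t).div (((hasDerivAt_pow 2 t).add_const ε).sqrt hpos.ne') hs.ne'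
  refine h.congr_deriv ?_
  simp only [id]
  field_simp
  rw [hsq]
  push_cast
  ring

theorem abs_div_sqrt_sq_add_le_one (hε : 0 < ε) (t : ℝ) : |t / √(t ^ 2 + ε)| ≤ 1 := by
  rw [abs_div, abs_of_nonneg (Real.sqrt_nonneg _)]
  exact div_le_one_of_le₀ (Real.abs_le_sqrt (by linarith)) (Real.sqrt_nonneg _)

theorem abs_div_sqrt_sq_add_pow_three_le (hε : 0 < ε) (t : ℝ) :
    |ε / √(t ^ 2 + ε) ^ 3| ≤ 1 / √ε := by
  have hs : 0 < √ε := Real.sqrt_pos.2 hε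
  have hle : √ε ≤ √(t ^ 2 + ε) := Real.sqrt_le_sqrt (by nlinarith [sq_nonneg t])
  rw [abs_of_nonneg (by positivity)]
  calc ε / √(t ^ 2 + ε) ^ 3 ≤ ε / √ε ^ 3 := by gcongr
    _ = √ε ^ 2 / √ε ^ 3 := by rw [Real.sq_sqrt hε.le]
    _ = 1 / √ε := by field_simp

end SmoothedSign

section InnerProductSpace

variable {E : Type*} [NormedAddCommGroup E] [InnerProductSpace ℝ E]

/-- Projecting onto the orthogonal complement of a unit vector does not increase the norm. -/
theorem norm_sub_inner_smul_le {x : E} (hx : ‖x‖ = 1) (w : E) : ‖w - ⟪x, w⟫ • x‖ ≤ ‖w‖ := by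
  refine le_of_pow_le_pow_left₀ two_ne_zero (norm_nonneg _) ?_
  rw [norm_sub_sq_real, norm_smul, hx, inner_smul_right, real_inner_comm x w, Real.norm_eq_abs,
    mul_one, sq_abs]
  nlinarith [sq_nonneg ⟪x, w⟫]

variable {ι : Type*} [Fintype ι] (M : ι → E) {ε : ℝ}

theorem hasFDerivAt_neg_sum_div_sqrt_smul (hε : 0 < ε) (x : E) :
    HasFDerivAt (fun y => -∑ i, (⟪M i, y⟫ / √(⟪M i, y⟫ ^ 2 + ε)) • M i)
      (-∑ i, ((ε / √(⟪M i, x⟫ ^ 2 + ε) ^ 3) • innerSL ℝ (M i)).smulRight (M i)) x := by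
  refine (HasFDerivAt.fun_sum fun i _ => ?_).neg
  exact ((hasDerivAt_div_sqrt_sq_add hε _).comp_hasFDerivAt x
    (innerSL ℝ (M i)).hasFDerivAt).smul_const (M i)

theorem norm_neg_sum_div_sqrt_smul_le (hε : 0 < ε) (x : E) :
    ‖-∑ i, (⟪M i, x⟫ / √(⟪M i, x⟫ ^ 2 + ε)) • M i‖ ≤ ∑ i, ‖M i‖ := by
  rw [norm_neg]
  refine norm_sum_le_of_le _ fun i _ => ?_
  rw [norm_smul, Real.norm_eq_abs]
  exact mul_le_of_le_one_left (norm_nonneg _) (abs_div_sqrt_sq_add_le_one hε _)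

theorem norm_neg_sum_smulRight_apply_le (hε : 0 < ε) (x v : E) :
    ‖(-∑ i, ((ε / √(⟪M i, x⟫ ^ 2 + ε) ^ 3) • innerSL ℝ (M i)).smulRight (M i)) v‖ ≤
      1 / √ε * (∑ i, ‖M i‖ ^ 2) * ‖v‖ := by
  rw [neg_apply, norm_neg, _root_.sum_apply, Finset.mul_sum,
    Finset.sum_mul]
  refine norm_sum_le_of_le _ fun i _ => ?_
  simp only [ContinuousLinearMap.smulRight_apply, smul_apply,
    innerSL_apply_apply, norm_smul, Real.norm_eq_abs]
  calc |ε / √(⟪M i, x⟫ ^ 2 + ε) ^ 3| * |⟪M i, v⟫| * ‖M i‖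
      ≤ 1 / √ε * (‖M i‖ * ‖v‖) * ‖M i‖ := by
        gcongr
        · exact abs_div_sqrt_sq_add_pow_three_le hε _
        · exact abs_real_inner_le_norm _ _
    _ = 1 / √ε * ‖M i‖ ^ 2 * ‖v‖ := by ring

/-- Projecting the derivative of the Riemannian gradient `y ↦ G y - ⟪y, G y⟫ • y` is the same as
projecting `DG(x)[v] - ⟪x, G x⟫ • v`, since the remaining terms are multiples of `x`. -/
theorem norm_proj_fderiv_sub_inner_smul_le {G : E → E} {G' : E →L[ℝ] E} {x : E}
    (hG : HasFDerivAt G G' x) (hx : ‖x‖ = 1) (v : E) :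
    ‖fderiv ℝ (fun y => G y - ⟪y, G y⟫ • y) x v -
        ⟪x, fderiv ℝ (fun y => G y - ⟪y, G y⟫ • y) x v⟫ • x‖ ≤ ‖G' v‖ + ‖G x‖ * ‖v‖ := by
  have hd : fderiv ℝ (fun y => G y - ⟪y, G y⟫ • y) x v =
      G' v - ⟪x, G x⟫ • v - (⟪x, G' v⟫ + ⟪v, G x⟫) • x := by
    have hid : HasFDerivAt (fun y : E => y) (.id ℝ E) x := hasFDerivAt_id x
    rw [(hG.fun_sub ((hid.inner ℝ hG).fun_smul hid)).fderiv]
    simp [sub_sub]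
  have hxx : ⟪x, x⟫ = 1 := by rw [real_inner_self_eq_norm_sq, hx, one_pow]
  have hproj (w : E) (c : ℝ) : w - c • x - ⟪x, w - c • x⟫ • x = w - ⟪x, w⟫ • x := by
    rw [inner_sub_right, inner_smul_right, hxx]
    module
  rw [hd, hproj]
  calc _ ≤ ‖G' v - ⟪x, G x⟫ • v‖ := norm_sub_inner_smul_le hx _
    _ ≤ ‖G' v‖ + |⟪x, G x⟫| * ‖v‖ := by
      simpa [norm_smul] using norm_sub_le (G' v) (⟪x, G x⟫ • v)
    _ ≤ ‖G' v‖ + ‖G x‖ * ‖v‖ := by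
      gcongr
      simpa [hx] using abs_real_inner_le_norm x (G x)

/-- The Riemannian Hessian of the smoothed `ℓ¹` objective is bounded uniformly on the sphere. -/
theorem norm_proj_fderiv_riemannianGradient_le (hε : 0 < ε) {x : E} (hx : ‖x‖ = 1) (v : E) :
    let ζ : E → E := fun y =>
      (-∑ i, (⟪M i, y⟫ / √(⟪M i, y⟫ ^ 2 + ε)) • M i) -
        ⟪y, -∑ i, (⟪M i, y⟫ / √(⟪M i, y⟫ ^ 2 + ε)) • M i⟫ • y
    ‖fderiv ℝ ζ x v - ⟪x, fderiv ℝ ζ x v⟫ • x‖ ≤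
      (4 / √ε * (∑ i, ‖M i‖ ^ 2) + 2 * ∑ i, ‖M i‖) * ‖v‖ := by
  have h₁ : 0 ≤ 1 / √ε * (∑ i, ‖M i‖ ^ 2) * ‖v‖ := by positivity
  have h₂ : 0 ≤ (∑ i, ‖M i‖) * ‖v‖ := by positivity
  have hG' := norm_neg_sum_smulRight_apply_le M hε x v
  have hG := mul_le_mul_of_nonneg_right (norm_neg_sum_div_sqrt_smul_le M hε x) (norm_nonneg v)
  refine (norm_proj_fderiv_sub_inner_smul_le
    (hasFDerivAt_neg_sum_div_sqrt_smul M hε x) hx v).trans ?_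
  linear_combination hG' + hG + 3 * h₁ + h₂

end InnerProductSpace

/-- For `f y = -∑ i, √(⟨M i, y⟩² + ε)` with Euclidean gradient
`G y = -∑ i, (⟨M i, y⟩/√(⟨M i, y⟩² + ε)) • M i`, the Riemannian-gradient vector field
`ζ y = G y - ⟨y, G y⟩ • y` is differentiable, and for every unit vector `x` and every
`v`, the projected derivative `(I - x xᵀ)·Dζ(x)[v]` satisfies
`‖(I - x xᵀ)·Dζ(x)[v]‖ ≤ ((4/√ε)·∑ i, ‖M i‖² + 2·∑ i, ‖M i‖)·‖v‖`; in particular the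
Riemannian Hessian of `f` on the sphere is uniformly bounded in operator norm. -/
theorem statement13 (m n : ℕ) (M : Fin m → EuclideanSpace ℝ (Fin n)) (ε : ℝ) (hε : 0 < ε)
    (G : EuclideanSpace ℝ (Fin n) → EuclideanSpace ℝ (Fin n))
    (hG : ∀ y, G y = -∑ i : Fin m, (⟪M i, y⟫ / Real.sqrt (⟪M i, y⟫ ^ 2 + ε)) • M i)
    (ζ : EuclideanSpace ℝ (Fin n) → EuclideanSpace ℝ (Fin n))
    (hζ : ∀ y, ζ y = G y - ⟪y, G y⟫ • y) :
    Differentiable ℝ ζ ∧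
    ∀ x : EuclideanSpace ℝ (Fin n), ‖x‖ = 1 →
      ∀ v : EuclideanSpace ℝ (Fin n),
        ‖fderiv ℝ ζ x v - ⟪x, fderiv ℝ ζ x v⟫ • x‖ ≤
          ((4 / Real.sqrt ε) * (∑ i : Fin m, ‖M i‖ ^ 2) +
            2 * ∑ i : Fin m, ‖M i‖) * ‖v‖ := by
  obtain rfl : G = _ := funext hG
  obtain rfl : ζ = _ := funext hζ
  refine ⟨fun x => ?_, fun x hx v => norm_proj_fderiv_riemannianGradient_le M hε hx v⟩
  have hd := (hasFDerivAt_neg_sum_div_sqrt_smul M hε x).differentiableAt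
  exact hd.fun_sub ((differentiableAt_fun_id.inner ℝ hd).fun_smul differentiableAt_fun_id)
end
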